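/- arXiv:1106.4415 — 3 statements merged into one kernel-verified Lean document; each statement's English description precedes it below -/
import Mathlib

section
/- In a Jordan algebra J over a field of characteristic ≠ 2, the quadratic representation P(x) := 2L(x)² − L(x²) satisfies the fundamental formula P(P(x)y) = P(x)P(y)P(x) for all x, y ∈ J. -/
/-- The quadratic representation `P(x) = 2 L(x)^2 - L(x^2)` of a Jordan algebra. -/
def quadRep {J : Type*} [NonUnitalNonAssocRing J] (x y : J) : J :=
  2 • (x * (x * y)) - (x * x) * y

/-- The Jordan triple product (up to a factor two). -/
def jtp {J : Type*} [NonUnitalNonAssocRing J] (a b c : J) : J :=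
  (a * b) * c + (b * c) * a - (a * c) * b

section aux
variable {J : Type*} [NonUnitalNonAssocRing J]

theorem lin_jordan (tor : ∀ a : J, a + a = 0 → a = 0)
    (comm : ∀ x y : J, x * y = y * x)
    (jordan : ∀ x y : J, (x * x) * (y * x) = ((x * x) * y) * x) (a b c w : J) :
    (a * b) * (w * c) + (b * c) * (w * a) + (c * a) * (w * b)
      = ((a * b) * w) * c + ((b * c) * w) * a + ((c * a) * w) * b := by
  have h1 := jordan (a + b + c) w
  have h2 := jordan (a + b) w
  have h3 := jordan (a + c) w
  have h4 := jordan (b + c) w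
  have h5 := jordan a w
  have h6 := jordan b w
  have h7 := jordan c w
  simp only [mul_add, add_mul, comm b a, comm c b, comm a c] at h1 h2 h3 h4 h5 h6 h7 ⊢
  refine sub_eq_zero.mp (tor _ ?_)
  linear_combination (norm := module) h1 - h2 - h3 - h4 + h5 + h6 + h7

theorem jtp_der (comm : ∀ x y : J, x * y = y * x)
    (lin : ∀ a b c w : J, (a * b) * (w * c) + (b * c) * (w * a) + (c * a) * (w * b)
      = ((a * b) * w) * c + ((b * c) * w) * a + ((c * a) * w) * b) (a b c d : J) :
    a * (b * (c * d)) - b * (a * (c * d))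
      = (a * (b * c) - b * (a * c)) * d + c * (a * (b * d) - b * (a * d)) := by
  have h1 := lin a c d b
  have h2 := lin b c d a
  simp only [mul_add, add_mul, mul_sub, sub_mul, comm] at h1 h2 ⊢
  linear_combination (norm := module) h2 - h1

theorem jtp_str (comm : ∀ x y : J, x * y = y * x)
    (lin : ∀ a b c w : J, (a * b) * (w * c) + (b * c) * (w * a) + (c * a) * (w * b)
      = ((a * b) * w) * c + ((b * c) * w) * a + ((c * a) * w) * b) (w c d e : J) :
    w * jtp c d e = jtp (w * c) d e - jtp c (w * d) e + jtp c d (w * e) := by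
  have h1 := lin c d w e
  have h2 := lin d e w c
  have h3 := lin c e w d
  simp only [jtp, mul_add, add_mul, mul_sub, sub_mul, comm] at h1 h2 h3 ⊢
  linear_combination (norm := module) h3 - h1 - h2

theorem jtp_sym (comm : ∀ x y : J, x * y = y * x)
    (jordan : ∀ x y : J, (x * x) * (y * x) = ((x * x) * y) * x)
    (lin : ∀ a b c w : J, (a * b) * (w * c) + (b * c) * (w * a) + (c * a) * (w * b)
      = ((a * b) * w) * c + ((b * c) * w) * a + ((c * a) * w) * b) (x y z : J) :
    jtp x y (jtp x z x) = jtp x z (jtp x y x) := by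
  have h1 := lin x y z (x * x)
  have h2 := lin (x * x) y z x
  have h3 := lin x x z (x * y)
  have h4 := lin x x (x * y) z
  have h5 := lin x (x * y) z x
  have h6 := lin x x y (x * z)
  have h7 := lin x (x * z) y x
  have h8 := lin x x (x * z) y
  have h9 := congrArg (x * ·) (lin x x z y)
  have h10 := congrArg (x * ·) (lin x x y z)
  have h11 := jordan x (y * z)
  have h12 := congrArg (y * ·) (jordan x z)
  simp only [jtp, mul_add, add_mul, mul_sub, sub_mul, comm] at *
  linear_combination (norm := module) (-1 : ℤ) • h1 + h2 + h3 + h4 - (2 : ℤ) • h5 - h6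
    + (2 : ℤ) • h7 - h8 - h9 + h10 + h11 - (2 : ℤ) • h12

theorem jtp_add_left (a a' b c : J) : jtp (a + a') b c = jtp a b c + jtp a' b c := by
  simp only [jtp, add_mul, mul_add]; abel
theorem jtp_add_mid (a b b' c : J) : jtp a (b + b') c = jtp a b c + jtp a b' c := by
  simp only [jtp, add_mul, mul_add]; abel
theorem jtp_add_right (a b c c' : J) : jtp a b (c + c') = jtp a b c + jtp a b c' := by
  simp only [jtp, add_mul, mul_add]; abel
theorem jtp_sub_left (a a' b c : J) : jtp (a - a') b c = jtp a b c - jtp a' b c := by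
  simp only [jtp, sub_mul, mul_sub]; abel
theorem jtp_sub_mid (a b b' c : J) : jtp a (b - b') c = jtp a b c - jtp a b' c := by
  simp only [jtp, sub_mul, mul_sub]; abel
theorem jtp_sub_right (a b c c' : J) : jtp a b (c - c') = jtp a b c - jtp a b c' := by
  simp only [jtp, sub_mul, mul_sub]; abel

theorem jtp_comm (comm : ∀ x y : J, x * y = y * x) (a b c : J) : jtp a b c = jtp c b a := by
  simp only [jtp, comm c b, comm b a, comm c a]; abel

theorem jtp_eq (comm : ∀ x y : J, x * y = y * x) (a b v : J) :
    jtp a b v = (a * b) * v + (a * (b * v) - b * (a * v)) := by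
  simp only [jtp, comm (b * v) a, comm (a * v) b]; abel

theorem jtp_der3 (comm : ∀ x y : J, x * y = y * x) (D : J → J)
    (hadd : ∀ u v, D (u + v) = D u + D v) (hsub : ∀ u v, D (u - v) = D u - D v)
    (hD : ∀ u v, D (u * v) = D u * v + u * D v) (c d e : J) :
    D (jtp c d e) = jtp (D c) d e + jtp c (D d) e + jtp c d (D e) := by
  simp only [jtp, hadd, hsub, hD, mul_add, add_mul]; abel

theorem jtp_five (comm : ∀ x y : J, x * y = y * x)
    (lin : ∀ a b c w : J, (a * b) * (w * c) + (b * c) * (w * a) + (c * a) * (w * b)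
      = ((a * b) * w) * c + ((b * c) * w) * a + ((c * a) * w) * b) (a b c d e : J) :
    jtp a b (jtp c d e) - jtp c d (jtp a b e)
      = jtp (jtp a b c) d e - jtp c (jtp b a d) e := by
  have h1 := jtp_str comm lin (a * b) c d e
  have h2 := jtp_der3 comm (fun v => a * (b * v) - b * (a * v))
    (by intro u v; simp only [mul_add]; abel) (by intro u v; simp only [mul_sub]; abel)
    (fun u v => jtp_der comm lin a b u v) c d e
  have e1 : jtp b a d = a * b * d - (a * (b * d) - b * (a * d)) := by
    rw [jtp_eq comm, comm b a]; abel
  rw [jtp_eq comm a b (jtp c d e), jtp_eq comm a b e, jtp_eq comm a b c, e1,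
    jtp_add_left, jtp_sub_mid, jtp_add_right]
  linear_combination (norm := module) h1 + h2

end aux

/-- In a Jordan algebra over a field of characteristic ≠ 2, the quadratic
representation satisfies the fundamental formula `P(P(x)y) = P(x)P(y)P(x)`. -/
theorem fundamental_formula {F J : Type*} [Field F] [NonUnitalNonAssocRing J]
    [Module F J] [SMulCommClass F J J] [IsScalarTower F J J]
    (h2 : (2 : F) ≠ 0)
    (comm : ∀ x y : J, x * y = y * x)
    (jordan : ∀ x y : J, (x * x) * (y * x) = ((x * x) * y) * x)
    (x y z : J) :
    quadRep (quadRep x y) z = quadRep x (quadRep y (quadRep x z)) := by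
  have tor : ∀ a : J, a + a = 0 → a = 0 := by
    intro a ha
    have : (2 : F) • a = 0 := by rw [two_smul, ha]
    exact (smul_eq_zero.mp this).resolve_left h2
  have lin := lin_jordan tor comm jordan
  have five := jtp_five comm lin
  have jc := jtp_comm comm
  have q : ∀ a b : J, quadRep a b = jtp a b a := by
    intro a b
    simp only [quadRep, jtp, comm b a, comm (a * b) a, two_smul]
  -- the identity `{x, y, P(x) z} = P(x) {y, x, z}`
  have jp1 : ∀ x y z : J, jtp x y (jtp x z x) = jtp x (jtp y x z) x := by
    intro x y z
    have h1 := five x y x z x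
    have h2 := jtp_sym comm jordan lin x y z
    rw [jc (jtp x y x) z x] at h1
    linear_combination (norm := module) (-1 : ℤ) • h1 + (2 : ℤ) • h2
  have d2 : ∀ x y z : J, jtp x y (jtp x y z) + jtp x y (jtp x y z)
      = jtp z y (jtp x y x) + jtp x (jtp y z y) x := by
    intro x y z
    have h1 := five z y x y x
    rw [jc (jtp z y x) y x, jc z y x] at h1
    linear_combination (norm := module) (-1 : ℤ) • h1
  simp only [q]
  have h := five x y x z (jtp x y x)
  rw [jp1 x z y, jp1 x y y, jp1 x z (jtp y x y), jp1 x (jtp y x z) y, jc z x y,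
    jp1 x y (jtp y x z), jc (jtp y x z) x y] at h
  have h3 := congrArg (fun v => jtp x v x) (d2 y x z)
  simp only [jtp_add_mid] at h3
  linear_combination (norm := module) h3 - h
end

section
/- For any element f of a Jordan algebra J, the mutation J_f with product {x f y} := x(yf) + y(xf) − (xy)f is again a Jordan algebra (commutative and satisfying the Jordan identity). -/
/-- The mutation product `{x f y} = x(yf) + y(xf) - (xy)f` of a Jordan algebra. -/
def mutProd {J : Type*} [NonUnitalNonAssocRing J] (f x y : J) : J :=
  x * (y * f) + y * (x * f) - (x * y) * f

theorem mj_lin {J : Type*} [NonUnitalNonAssocRing J]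
    (two : ∀ a : J, a + a = 0 → a = 0)
    (comm : ∀ x y : J, x * y = y * x)
    (jordan : ∀ x y : J, (x * x) * (y * x) = ((x * x) * y) * x) (a b c d : J) :
    (a*b)*(c*d) + (b*c)*(a*d) + (c*a)*(b*d) - ((a*b)*d)*c - ((b*c)*d)*a - ((c*a)*d)*b = 0 := by
  apply two
  have h1 := jordan (a+b+c) d
  have h2 := jordan (a+b) d
  have h3 := jordan (b+c) d
  have h4 := jordan (a+c) d
  have h5 := jordan a d
  have h6 := jordan b d
  have h7 := jordan c d
  rw [← sub_eq_zero] at h1 h2 h3 h4 h5 h6 h7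
  have h : ((a+b+c)*(a+b+c)*(d*(a+b+c)) - (a+b+c)*(a+b+c)*d*(a+b+c))
    - ((a+b)*(a+b)*(d*(a+b)) - (a+b)*(a+b)*d*(a+b))
    - ((b+c)*(b+c)*(d*(b+c)) - (b+c)*(b+c)*d*(b+c))
    - ((a+c)*(a+c)*(d*(a+c)) - (a+c)*(a+c)*d*(a+c))
    + (a*a*(d*a) - a*a*d*a) + (b*b*(d*b) - b*b*d*b) + (c*c*(d*c) - c*c*d*c) = 0 := by
    rw [h1, h2, h3, h4, h5, h6, h7]; simp
  rw [← h]
  simp only [mul_add, add_mul, comm b a, comm c a, comm c b, comm d a, comm d b, comm d c]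
  abel

set_option maxHeartbeats 2000000 in
theorem mj_A {J : Type*} [NonUnitalNonAssocRing J]
    (two : ∀ a : J, a + a = 0 → a = 0)
    (comm : ∀ x y : J, x * y = y * x)
    (jordan : ∀ x y : J, (x * x) * (y * x) = ((x * x) * y) * x) (x f w : J) :
    mutProd (mutProd w f f) x x = mutProd f x (mutProd f x w) + mutProd f x (mutProd f x w) - mutProd f w (mutProd f x x) := by
  have L := mj_lin two comm jordan
  rw [← sub_eq_zero]
  have h0 := congrArg (fun t => t * x) (L x f w f)
  have h1 := L (f*x) w f x
  have h2 := L w f x (f*x)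
  have h3 := congrArg (fun t => t * x) (L f x f w)
  have h4 := congrArg (fun t => t * w) (L f x x f)
  have h5 := L (f*x) x f w
  have h6 := congrArg (fun t => t * f) (L w x x f)
  have h7 := L (f*w) x f x
  have h8 := L x f x (f*w)
  have h9 := L (f*x) x w f
  have h10 := L (x*x) f f w
  have h11 := L f f w (x*x)
  have h12 := L (f*w) x x f
  simp only [mul_add, add_mul, mul_sub, sub_mul, zero_mul, mul_zero, comm] at h0 h1 h2 h3 h4 h5 h6 h7 h8 h9 h10 h11 h12
  simp only [mutProd, mul_add, add_mul, mul_sub, sub_mul, comm]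
  linear_combination (norm := module) (-2 : ℤ) • h0 + (-2 : ℤ) • h1 + (2 : ℤ) • h2 + (2 : ℤ) • h3 + (1 : ℤ) • h4 + (2 : ℤ) • h5 + (1 : ℤ) • h6 + (-2 : ℤ) • h7 + (-1 : ℤ) • h8 + (-2 : ℤ) • h9 + (-1 : ℤ) • h10 + (1 : ℤ) • h11 + (1 : ℤ) • h12

set_option maxHeartbeats 2000000 in
theorem mj_B {J : Type*} [NonUnitalNonAssocRing J]
    (two : ∀ a : J, a + a = 0 → a = 0)
    (comm : ∀ x y : J, x * y = y * x)
    (jordan : ∀ x y : J, (x * x) * (y * x) = ((x * x) * y) * x) (x y z : J) :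
    mutProd y x (mutProd z x x) = mutProd (mutProd x y z) x x := by
  have L := mj_lin two comm jordan
  rw [← sub_eq_zero]
  have h0 := L (x*x) y x z
  have h1 := L y x z (x*x)
  have h2 := congrArg (fun t => t * y) (L x z x x)
  have h3 := L (x*z) x x y
  have h4 := L x x y (x*z)
  have h5 := congrArg (fun t => t * z) (sub_eq_zero.mpr (jordan x y))
  have h6 := congrArg (fun t => t * x) (L y x x z)
  have h7 := L (x*x) y z x
  have h8 := L (y*z) x x x
  have h9 := sub_eq_zero.mpr (jordan x (y*z))
  have h10 := congrArg (fun t => t * x) (L x x z y)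
  simp only [mul_add, add_mul, mul_sub, sub_mul, zero_mul, mul_zero, comm] at h0 h1 h2 h3 h4 h5 h6 h7 h8 h9 h10
  simp only [mutProd, mul_add, add_mul, mul_sub, sub_mul, comm]
  linear_combination (norm := module) (-1 : ℤ) • h0 + (1 : ℤ) • h1 + (1 : ℤ) • h2 + (-1 : ℤ) • h3 + (2 : ℤ) • h4 + (1 : ℤ) • h5 + (1 : ℤ) • h6 + (-1 : ℤ) • h7 + (-1 : ℤ) • h8 + (1 : ℤ) • h9 + (1 : ℤ) • h10

theorem mj_comm {J : Type*} [NonUnitalNonAssocRing J]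
    (comm : ∀ x y : J, x * y = y * x) (f x y : J) : mutProd f x y = mutProd f y x := by
  simp only [mutProd, comm x y]; abel

/-- For any element `f` of a Jordan algebra over a field of characteristic ≠ 2,
the mutation `J_f` with product `{x f y}` is again a Jordan algebra: commutative
and satisfying the Jordan identity. -/
theorem mutation_is_jordan {F J : Type*} [Field F] [NonUnitalNonAssocRing J]
    [Module F J] [SMulCommClass F J J] [IsScalarTower F J J]
    (h2 : (2 : F) ≠ 0)
    (comm : ∀ x y : J, x * y = y * x)
    (jordan : ∀ x y : J, (x * x) * (y * x) = ((x * x) * y) * x)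
    (f : J) :
    (∀ x y : J, mutProd f x y = mutProd f y x) ∧
    (∀ x y : J, mutProd f (mutProd f x x) (mutProd f y x) = mutProd f (mutProd f (mutProd f x x) y) x) := by
  have two : ∀ a : J, a + a = 0 → a = 0 := by
    intro a ha
    rw [← two_smul F] at ha
    exact (smul_eq_zero.mp ha).resolve_left h2
  have A := mj_A two comm jordan
  have B := mj_B two comm jordan
  have C := mj_comm comm
  refine ⟨C f, fun x y => ?_⟩
  have e1 : mutProd f x (mutProd (mutProd y f f) x x)
      = mutProd (mutProd (mutProd f x y) f f) x x := by
    rw [B x f, B f x y]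
  rw [A, A] at e1
  have add : ∀ u v w : J, mutProd f u (v - w) = mutProd f u v - mutProd f u w := by
    intro u v w; simp only [mutProd, mul_sub, sub_mul]; abel
  have add' : ∀ u v w : J, mutProd f u (v + w) = mutProd f u v + mutProd f u w := by
    intro u v w; simp only [mutProd, mul_add, add_mul]; abel
  rw [add, add'] at e1
  have e2 := sub_right_injective e1
  rw [C f _ (mutProd f x x), C f _ (mutProd f x x)] at e2
  rw [C f y x, ← e2, C f x]
end

section
/- In a unital Jordan algebra J, an element x is invertible with inverse y if and only if xy = e and x²y = x. -/
theorem eMul {J : Type*} [AddCommGroup J] (f g : AddMonoid.End J) (z : J) : (f * g) z = f (g z) := rfl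

theorem eAdd {J : Type*} [AddCommGroup J] (f g : AddMonoid.End J) (z : J) : (f + g) z = f z + g z := rfl

theorem eSub {J : Type*} [AddCommGroup J] (f g : AddMonoid.End J) (z : J) : (f - g) z = f z - g z := rfl

theorem eOne {J : Type*} [AddCommGroup J] (z : J) : (1 : AddMonoid.End J) z = z := rfl

theorem jlin {J : Type*} [NonUnitalNonAssocRing J] (half : ∀ z : J, z + z = 0 → z = 0)
    (comm : ∀ x y : J, x * y = y * x)
    (jordan : ∀ x y : J, (x * x) * (y * x) = ((x * x) * y) * x) (a b c z : J) :
    a * ((b * c) * z) + b * ((c * a) * z) + c * ((a * b) * z) =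
      (b * c) * (a * z) + (c * a) * (b * z) + (a * b) * (c * z) := by
  let _ : NonUnitalNonAssocCommRing J := { ‹NonUnitalNonAssocRing J› with mul_comm := comm }
  have : IsCommJordan J := ⟨fun a b => by
    have := jordan a b
    rw [comm (a * b), comm a b, this, comm _ a, comm b]⟩
  have h := two_nsmul_lie_lmul_lmul_add_add_eq_zero a b c
  have h' := DFunLike.congr_fun h z
  simp only [Ring.lie_def, two_nsmul] at h'
  have h3 := half _ h'
  have h4 : (a * ((b * c) * z) - (b * c) * (a * z)) + (b * ((c * a) * z) - (c * a) * (b * z)) +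
    (c * ((a * b) * z) - (a * b) * (c * z)) = 0 := h3
  rw [← sub_eq_zero, ← h4]
  abel

theorem jop {J : Type*} [NonUnitalNonAssocRing J] (half : ∀ z : J, z + z = 0 → z = 0)
    (comm : ∀ x y : J, x * y = y * x)
    (jordan : ∀ x y : J, (x * x) * (y * x) = ((x * x) * y) * x)
    (e : J) (he : ∀ y : J, e * y = y) (x y : J) (h1 : x * y = e) (h2 : (x * x) * y = x)
    (z : J) (hz : quadRep x z = 0) : z = 0 := by
  have lin := jlin half comm jordan
  obtain ⟨L, hL⟩ : ∃ L : J → AddMonoid.End J, ∀ a b, L a b = a * b :=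
    ⟨AddMonoid.End.mulLeft, fun a b => rfl⟩
  have I1 : ∀ a b c, L a * L (b * c) + L b * L (c * a) + L c * L (a * b) =
      L (b * c) * L a + L (c * a) * L b + L (a * b) * L c := by
    intro a b c; ext z
    simpa [eAdd, eMul, hL] using lin a b c z
  have I2 : ∀ b c d, L ((b * c) * d) + L b * L d * L c + L c * L d * L b =
      L (b * c) * L d + L (b * d) * L c + L (c * d) * L b := by
    intro b c d; ext v
    have := lin v b c d
    simp only [eAdd, eMul, hL]
    rw [comm _ v, comm d (c * v), comm d (b * v), comm d v, comm b v, comm (b * d), comm (c * d)]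
    rw [comm (v * b) (c * d), comm (c * v) (b * d)] at this
    rw [this, comm c v, comm (b * d), comm (c * d)]
  have Le : L e = 1 := by ext z; simp [hL, he]
  have halfE : ∀ f : AddMonoid.End J, f + f = 0 → f = 0 := fun f hf => by
    ext z; exact half _ (DFunLike.congr_fun hf z)
  have h1' : y * x = e := by rw [comm, h1]
  have h2' : y * (x * x) = x := by rw [comm, h2]
  have he' : ∀ y, y * e = y := fun y => by rw [comm, he]
  obtain ⟨D, hD⟩ : ∃ D, D = L x * L y - L y * L x := ⟨_, rfl⟩
  have der : ∀ c, D * L c - L c * D = L (D c) := by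
    intro c
    have i1 := I2 x c y
    have i2 := I2 y c x
    have k : L (D c) = L (y * c * x) - L (x * c * y) := by
      ext v
      rw [hD]
      simp only [eSub, eMul, hL]
      rw [comm x (y * c), comm y (x * c), sub_mul]
    rw [comm y x, comm c x] at i2
    rw [comm c y] at i1
    rw [k, hD]
    linear_combination (norm := noncomm_ring) i1 - i2
  -- [L_y, L_{x²}] = 0
  have c1 : L y * L (x * x) = L (x * x) * L y := by
    have := I1 x x y
    simp only [h1, h1', Le, mul_one, one_mul] at this
    linear_combination (norm := noncomm_ring) this
  have c2 : L x * L (y * y) = L (y * y) * L x := by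
    have := I1 y y x
    simp only [h1, h1', Le, mul_one, one_mul] at this
    linear_combination (norm := noncomm_ring) this
  have e1 : 2 * (L x * L y * L x) = L x + L (x * x) * L y := by
    have := I2 x x y
    simp only [h1, h1', h2, Le, mul_one, one_mul] at this
    linear_combination (norm := noncomm_ring) this
  have hDx : D x = 0 := by
    have : D x = x * (y * x) - y * (x * x) := by rw [hD]; simp only [eSub, eMul, hL]
    rw [this, h1', h2', he', sub_self]
  have hDcx : D * L x = L x * D := by
    have := der x
    have h0 : L 0 = 0 := by ext; simp [hL]
    rw [hDx, h0] at this
    exact sub_eq_zero.mp this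
  -- w = 0
  have hxy2 : x * (y * y) = y := by
    obtain ⟨w, hw⟩ : ∃ w, w = x * (y * y) - y := ⟨_, rfl⟩
    have hDy : D y = w := by
      have : D y = x * (y * y) - y * (x * y) := by rw [hD]; simp only [eSub, eMul, hL]
      rw [this, h1, he', hw]
    have q1 : (x * x) * (y * y) = e := by
      have := DFunLike.congr_fun c1 y
      simp only [eMul, hL, h2, h1'] at this
      exact this.symm
    have q2 : x * (x * (y * y)) = e := by
      have := DFunLike.congr_fun c2 x
      simp only [eMul, hL] at this
      rw [comm x (y * y), this, comm, q1]
    have hxw : x * w = 0 := by rw [hw, mul_sub, q2, h1, sub_self]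
    have hLw : L (x * (y * y)) = L w + L y := by ext v; simp [eAdd, hL, hw, sub_mul]
    have s2 : L y * L x + L y * L x + L (x * x) * L (y * y) =
        L x * L y + L x * L y + L (y * y) * L (x * x) := by
      have := I1 y y (x * x)
      simp only [h2, h2'] at this
      linear_combination (norm := noncomm_ring) this
    have cw : L x * L w = L w * L x := by
      have := I1 (y * y) x x
      rw [comm (y * y) x, hLw] at this
      have t : (L x * L w - L w * L x) + (L x * L w - L w * L x) = 0 := by
        linear_combination (norm := noncomm_ring) this + s2
      exact sub_eq_zero.mp (halfE _ t)
    have hxyw : x * (y * w) = w := by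
      have := DFunLike.congr_fun cw y
      simp only [eMul, hL, h1, he'] at this
      rw [comm y w, this]
    have hDw : D w = w := by
      have : D w = x * (y * w) - y * (x * w) := by rw [hD]; simp only [eSub, eMul, hL]
      rw [this, hxyw, hxw]; simp
    have r1 : w * w + y * w = 0 := by
      have := I2 y y x
      rw [comm (y * y) x, hLw, h1', Le] at this
      have := DFunLike.congr_fun this w
      simp only [eMul, eAdd, hL, hxyw, hxw, eOne] at this
      have t : w * w + y * w + (y * w + y * w) = 0 + (y * w + y * w) := by
        calc _ = w * w + y * w + y * w + y * w := by abel
          _ = _ := by rw [this]; simp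
      exact add_right_cancel t
    have dd : ∀ c v, D (c * v) = D c * v + c * D v := by
      intro c v
      have := DFunLike.congr_fun (der c) v
      have : D (L c v) - L c (D v) = L (D c) v := this
      simp only [hL] at this
      rw [← this]; abel
    have r2 : w * w = 0 := by
      apply half
      have := dd (w + y) w
      rw [add_mul, r1] at this
      simp only [map_add, map_zero, hDw, hDy, add_mul, r1] at this
      simpa using this.symm
    have r3 : y * w = 0 := by rw [r2] at r1; simpa using r1
    rw [r3, mul_zero] at hxyw
    rw [← hxyw] at hw
    exact (sub_eq_zero.mp hw.symm)
  have hyyx : (y * y) * x = y := by rw [comm, hxy2]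
  have e2 : 2 * (L y * L x * L y) = L y + L (y * y) * L x := by
    have := I2 y y x
    simp only [h1, h1', hyyx, Le, mul_one, one_mul] at this
    linear_combination (norm := noncomm_ring) this
  have hDD : L (x * x) * L (y * y) - L (y * y) * L (x * x) = D + D := by
    have := I1 y y (x * x)
    simp only [h2, h2'] at this
    rw [hD]
    linear_combination (norm := noncomm_ring) this
  have cyy : L y * L (y * y) = L (y * y) * L y := by
    ext v
    have := jordan y v
    simp only [eMul, hL]
    rw [comm y v, this, comm]
  have cxx : L x * L (x * x) = L (x * x) * L x := by
    ext v
    have := jordan x v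
    simp only [eMul, hL]
    rw [comm x v, this, comm]
  have DLy : D * L y = 0 := by
    apply halfE
    rw [← add_mul, ← hDD]
    have a1 : L (x * x) * L y = 2 * (L x * L y * L x) - L x := by rw [e1]; abel
    have a2 : L (y * y) * (L x * L y * L x) = (L x * L y * L x) * L (y * y) := by
      calc _ = (L (y * y) * L x) * L y * L x := by noncomm_ring
        _ = L x * (L (y * y) * L y) * L x := by rw [← c2]; noncomm_ring
        _ = L x * L y * (L (y * y) * L x) := by rw [← cyy]; noncomm_ring
        _ = _ := by rw [← c2]; noncomm_ring
    have a3 : (L (x * x) * L (y * y) - L (y * y) * L (x * x)) * L y =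
      (L (x * x) * L y) * L (y * y) - L (y * y) * (L (x * x) * L y) := by
      rw [mul_assoc (L (x * x)) (L y), cyy]; noncomm_ring
    rw [a3, a1]
    linear_combination (norm := noncomm_ring) (-2) * a2 - c2
  have hDcy : D * L y = L y * D := by
    have hDy : D y = 0 := by
      have : D y = x * (y * y) - y * (x * y) := by rw [hD]; simp only [eSub, eMul, hL]
      rw [this, h1, he', hxy2, sub_self]
    have := der y
    have h0 : L 0 = 0 := by ext; simp [hL]
    rw [hDy, h0] at this
    exact sub_eq_zero.mp this
  have DLx : D * L x = 0 := by
    apply halfE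
    rw [← add_mul, ← hDD]
    have a1 : L (y * y) * L x = 2 * (L y * L x * L y) - L y := by rw [e2]; abel
    have a2 : L (x * x) * (L y * L x * L y) = (L y * L x * L y) * L (x * x) := by
      calc _ = (L (x * x) * L y) * L x * L y := by noncomm_ring
        _ = L y * (L (x * x) * L x) * L y := by rw [← c1]; noncomm_ring
        _ = L y * L x * (L (x * x) * L y) := by rw [← cxx]; noncomm_ring
        _ = _ := by rw [← c1]; noncomm_ring
    have a3 : (L (x * x) * L (y * y) - L (y * y) * L (x * x)) * L x =
      L (x * x) * (L (y * y) * L x) - (L (y * y) * L x) * L (x * x) := by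
      rw [mul_assoc (L (y * y)) (L x), cxx]; noncomm_ring
    rw [a3, a1]
    linear_combination (norm := noncomm_ring) 2 * a2 + c1
  have b1 : L y * L x * L x = L x * L x * L y := by
    have : L x * D = 0 := by rw [← hDcx, DLx]
    rw [hD] at this DLx
    linear_combination (norm := noncomm_ring) (-1) * this - DLx
  have b2 : L y * (2 * (L x * L x) - L (x * x)) = L x := by
    have : L x * D = 0 := by rw [← hDcx, DLx]
    rw [hD] at this DLx
    linear_combination (norm := noncomm_ring) e1 - c1 - 2 * DLx
  have hP : (2 * (L x * L x) - L (x * x)) z = 0 := by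
    rw [← hz, quadRep, two_nsmul, two_mul]
    simp only [eSub, eAdd, eMul, hL]
  have xz : x * z = 0 := by
    have := DFunLike.congr_fun b2 z
    rw [eMul, hP] at this
    simpa [hL] using this.symm
  have xxz : (x * x) * z = 0 := by
    have := hz
    simp only [quadRep, xz] at this
    simpa using this
  have yz : y * z = 0 := by
    have a : L y * L x * L y = L y * L y * L x := by
      have : L y * D = 0 := by rw [← hDcy, DLy]
      rw [hD] at this
      linear_combination (norm := noncomm_ring) this
    have b : L y = (2 * (L y * L y) - L (y * y)) * L x := by
      linear_combination (norm := noncomm_ring) 2 * a - e2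
    have := DFunLike.congr_fun b z
    simpa [eSub, eMul, hL, xz] using this
  have f := I2 (x * x) y y
  rw [h2, h1, Le] at f
  have := DFunLike.congr_fun f z
  simpa [eAdd, eMul, eOne, hL, xz, yz, xxz] using this

/-- In a unital finite-dimensional Jordan algebra over a field of characteristic ≠ 2,
an element `x` is invertible with inverse `y` (i.e. `P(x)` is bijective and
`P(x) y = x`) if and only if `xy = e` and `x²y = x`. -/
theorem invertible_iff {F J : Type*} [Field F] [NonUnitalNonAssocRing J]
    [Module F J] [SMulCommClass F J J] [IsScalarTower F J J] [FiniteDimensional F J]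
    (h2 : (2 : F) ≠ 0)
    (comm : ∀ x y : J, x * y = y * x)
    (jordan : ∀ x y : J, (x * x) * (y * x) = ((x * x) * y) * x)
    (e : J) (he : ∀ y : J, e * y = y)
    (x y : J) :
    (Function.Bijective (quadRep x) ∧ quadRep x y = x) ↔
      (x * y = e ∧ (x * x) * y = x) := by
  have half : ∀ z : J, z + z = 0 → z = 0 := by
    intro z hz
    rw [← two_smul F z] at hz
    exact (smul_eq_zero.mp hz).resolve_left h2
  have he' : ∀ y, y * e = y := fun y => by rw [comm, he]
  constructor
  · rintro ⟨hb, hxy⟩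
    have h1 : x * y = e := by
      apply hb.1
      have j : (x * x) * (x * y) = x * ((x * x) * y) := by
        rw [comm x y, jordan, comm]
      have : quadRep x (x * y) = x * quadRep x y := by
        simp only [quadRep, mul_sub, two_nsmul, mul_add, j]
      rw [this, hxy]
      simp only [quadRep, he', two_nsmul]
      abel
    refine ⟨h1, ?_⟩
    simp only [quadRep, h1, he', two_nsmul] at hxy
    have : x + x - x * x * y - x = 0 := by rw [hxy, sub_self]
    rw [eq_comm, ← sub_eq_zero, ← this]
    abel
  · rintro ⟨h1, h3⟩
    let f : J →ₗ[F] J := 2 • (LinearMap.mulLeft F x ∘ₗ LinearMap.mulLeft F x) - LinearMap.mulLeft F (x * x)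
    have hf : ⇑f = quadRep x := by
      ext z; simp [f, quadRep]
    have inj : Function.Injective f := by
      rw [injective_iff_map_eq_zero]
      intro z hz
      rw [hf] at hz
      exact jop half comm jordan e he x y h1 h3 z hz
    refine ⟨?_, ?_⟩
    · rw [← hf]
      exact ⟨inj, LinearMap.injective_iff_surjective.mp inj⟩
    · simp only [quadRep, h1, he', h3, two_nsmul]
      abel
end
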